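/- Let w ∈ {0, 1, …, r} with gcd(m, λ_w) = 1 and let λ' be an integer with λ'·λ_w ≡ 1 (mod m). Then a nonnegative integer a is an arithmetic pure gap at the single index (w) (i.e., the 1-tuple (a) is an arithmetic pure gap at (w)) if and only if ∑_{i=0}^{r} ⌊(−a·λ'·λ_i)/m⌋ + ⌈a/m⌉ ≤ −1. -/

import Mathlib

open Finset

/-- Floor of the rational number `x / m`. -/
noncomputable def fdivq (m : ℕ) (x : ℤ) : ℤ := ⌊(x : ℚ) / (m : ℚ)⌋

/-- The quantity `∑_{i=0}^{n-1} ⌊(a_i + t·λ_{c i})/m⌋ + ∑_{w ∉ range c} ⌊t·λ_w/m⌋`. -/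
noncomputable def gapSum (m r n : ℕ) (lam : Fin (r + 1) → ℤ)
    (c : Fin n → Fin (r + 1)) (a : Fin n → ℤ) (t : ℤ) : ℤ :=
  (∑ i : Fin n, fdivq m (a i + t * lam (c i))) +
    ∑ w ∈ Finset.univ \ Finset.image c Finset.univ, fdivq m (t * lam w)

/-- `(a 0, …, a (n-1))` is an *arithmetic pure gap* at the (pairwise distinct) indices
`c 0, …, c (n-1)` of `{0,…,r}`: the entries are nonnegative and for every
`t ∈ {0,…,m-1}` exactly one of the two Bartoli–Quoos–Zini conditions holds. -/
noncomputable def IsArithPureGap (m r n : ℕ) (lam : Fin (r + 1) → ℤ)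
    (c : Fin n → Fin (r + 1)) (a : Fin n → ℤ) : Prop :=
  (∀ i, 0 ≤ a i) ∧
    ∀ t : ℤ, 0 ≤ t → t ≤ (m : ℤ) - 1 →
      Xor' (gapSum m r n lam c a t < 0)
        (0 ≤ gapSum m r n lam c a t ∧
          ∀ i : Fin n, fdivq m (a i + t * lam (c i)) = fdivq m (a i + t * lam (c i) - 1))

theorem fdivq_eq_ediv (m : ℕ) (x : ℤ) : fdivq m x = x / (m : ℤ) := by
  simpa [fdivq] using Rat.floor_intCast_div_natCast x m

theorem fdivq_add_mul {m : ℕ} (hm : m ≠ 0) (x q : ℤ) : fdivq m (x + m * q) = fdivq m x + q := by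
  rw [fdivq_eq_ediv, fdivq_eq_ediv, Int.add_mul_ediv_left _ _ (by exact_mod_cast hm)]

theorem ceil_div_eq_neg_fdivq (m : ℕ) (a : ℤ) : ⌈(a : ℚ) / (m : ℚ)⌉ = -fdivq m (-a) := by
  rw [fdivq, Int.cast_neg, neg_div, Int.floor_neg, neg_neg]

theorem fdivq_eq_fdivq_sub_one_iff {m : ℕ} (hm : 0 < m) (x : ℤ) :
    fdivq m x = fdivq m (x - 1) ↔ ¬ (m : ℤ) ∣ x := by
  have hm' : (0 : ℤ) < m := by exact_mod_cast hm
  rw [fdivq_eq_ediv, fdivq_eq_ediv]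
  constructor
  · rintro h ⟨k, rfl⟩
    rw [Int.mul_ediv_cancel_left _ hm'.ne', eq_comm, Int.ediv_eq_iff_of_pos hm'] at h
    linarith [h.1, mul_comm k (m : ℤ)]
  · intro h
    have h1 := Int.emod_add_mul_ediv x m
    have h2 := Int.emod_lt_of_pos x hm'
    have h3 := Int.emod_nonneg x hm'.ne'
    have h4 : x % m ≠ 0 := fun h0 => h (Int.dvd_of_emod_eq_zero h0)
    have h5 : 1 ≤ x % m := by omega
    symm
    rw [Int.ediv_eq_iff_of_pos hm']
    constructor <;> linarith [mul_comm (x / m) (m : ℤ)]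

theorem gapSum_single (m r : ℕ) (lam : Fin (r + 1) → ℤ) (w : Fin (r + 1)) (a t : ℤ) :
    gapSum m r 1 lam (fun _ => w) (fun _ => a) t =
      fdivq m (a + t * lam w) - fdivq m (t * lam w) + ∑ i, fdivq m (t * lam i) := by
  have himage : Finset.image (fun _ : Fin 1 => w) Finset.univ = {w} := by
    ext; simp [eq_comm]
  rw [gapSum, himage, ← Finset.sum_sdiff (Finset.subset_univ {w})]
  simp
  ring

/-- At an index `t` where `a + t·λ_w` is a multiple of `m`, the gap sum is a plain floor sum
corrected by `⌈a/m⌉`. -/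
theorem gapSum_single_of_dvd {m : ℕ} (hm : m ≠ 0) (r : ℕ) (lam : Fin (r + 1) → ℤ)
    (w : Fin (r + 1)) (a t : ℤ) (h : (m : ℤ) ∣ a + t * lam w) :
    gapSum m r 1 lam (fun _ => w) (fun _ => a) t =
      (∑ i, fdivq m (t * lam i)) + ⌈(a : ℚ) / (m : ℚ)⌉ := by
  obtain ⟨k, hk⟩ := h
  have h1 : fdivq m (a + t * lam w) = k := by
    rw [hk, fdivq_eq_ediv, Int.mul_ediv_cancel_left _ (by exact_mod_cast hm)]
  have h2 : fdivq m (t * lam w) = fdivq m (-a) + k := by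
    rw [← fdivq_add_mul hm, ← hk]
    ring_nf
  rw [gapSum_single, h1, h2, ceil_div_eq_neg_fdivq]
  ring

theorem sum_fdivq_mul_eq_of_modEq {ι : Type*} [Fintype ι] {m : ℕ} (hm : m ≠ 0) (lam : ι → ℤ)
    (hsum : ∑ i, lam i = 0) {s t : ℤ} (h : s ≡ t [ZMOD m]) :
    ∑ i, fdivq m (s * lam i) = ∑ i, fdivq m (t * lam i) := by
  obtain ⟨q, hq⟩ := h.dvd
  have h1 : ∀ i, fdivq m (t * lam i) = fdivq m (s * lam i) + q * lam i := fun i => by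
    rw [← fdivq_add_mul hm, eq_add_of_sub_eq hq]
    ring_nf
  simp [h1, Finset.sum_add_distrib, ← Finset.mul_sum, hsum]

theorem dvd_add_mul_iff_modEq {n a t u v : ℤ} (h : v * u ≡ 1 [ZMOD n]) :
    n ∣ a + t * u ↔ -(a * v) ≡ t [ZMOD n] := by
  obtain ⟨c, hc⟩ := h.dvd
  rw [Int.modEq_iff_dvd]
  constructor
  · rintro ⟨k, hk⟩
    exact ⟨k * v + t * c, by linear_combination v * hk + t * hc⟩
  · rintro ⟨k, hk⟩
    exact ⟨k * u + a * c, by linear_combination u * hk + a * hc⟩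

/-- The gap set at a single totally ramified place:
`a` is a gap at the index `w` iff `∑_{i=0}^{r} ⌊(−a·λ'·λ_i)/m⌋ + ⌈a/m⌉ ≤ −1`. -/
theorem single_gap_iff (m r : ℕ) (hm : 2 ≤ m) (hr : 1 ≤ r)
    (lam : Fin (r + 1) → ℤ) (hlam : ∀ i, lam i ≠ 0) (hsum : ∑ i, lam i = 0)
    (w : Fin (r + 1)) (hgcd : Int.gcd (m : ℤ) (lam w) = 1)
    (lam' : ℤ) (hinv : Int.ModEq (m : ℤ) (lam' * lam w) 1)
    (a : ℤ) (ha : 0 ≤ a) :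
    IsArithPureGap m r 1 lam (fun _ => w) (fun _ => a) ↔
      (∑ i : Fin (r + 1), fdivq m (-(a * lam') * lam i)) + ⌈(a : ℚ) / (m : ℚ)⌉ ≤ -1 := by
  have hm0 : m ≠ 0 := by omega
  have hmpos : (0 : ℤ) < m := by omega
  have hgap : ∀ t : ℤ, (m : ℤ) ∣ a + t * lam w →
      gapSum m r 1 lam (fun _ => w) (fun _ => a) t =
        (∑ i, fdivq m (-(a * lam') * lam i)) + ⌈(a : ℚ) / (m : ℚ)⌉ := fun t ht => by
    rw [gapSum_single_of_dvd hm0 r lam w a t ht,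
      sum_fdivq_mul_eq_of_modEq hm0 lam hsum ((dvd_add_mul_iff_modEq hinv).1 ht)]
  simp only [IsArithPureGap, fdivq_eq_fdivq_sub_one_iff (Nat.pos_of_ne_zero hm0), forall_const]
  constructor
  · rintro ⟨-, h⟩
    have hdvd : (m : ℤ) ∣ a + (-(a * lam') % m) * lam w :=
      (dvd_add_mul_iff_modEq hinv).2 (Int.mod_modEq _ _).symm
    rcases h (-(a * lam') % m) (Int.emod_nonneg _ hmpos.ne')
      (Int.le_sub_one_of_lt (Int.emod_lt_of_pos _ hmpos)) with ⟨hneg, -⟩ | ⟨⟨-, hnd⟩, -⟩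
    · rw [hgap _ hdvd] at hneg
      omega
    · exact absurd hdvd hnd
  · refine fun h => ⟨ha, fun t _ _ => ?_⟩
    by_cases hdvd : (m : ℤ) ∣ a + t * lam w
    · exact Or.inl ⟨by rw [hgap t hdvd]; omega, fun hc => hc.2 hdvd⟩
    · rcases lt_or_ge (gapSum m r 1 lam (fun _ => w) (fun _ => a) t) 0 with hneg | hnonneg
      · exact Or.inl ⟨hneg, fun hc => hc.1.not_gt hneg⟩
      · exact Or.inr ⟨⟨hnonneg, hdvd⟩, hnonneg.not_gt⟩
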